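/- arXiv:1410.8622 — 5 statements merged into one kernel-verified Lean document; each statement's English description precedes it below -/
import Mathlib

section
/- Let H be a Polish space and let (P_t)_{t≥0} be a Markov semigroup of kernels on H (P_0(x,·) = δ_x and P_{t+s}(x,Γ) = ∫ P_t(y,Γ) P_s(x,dy) for all s,t ≥ 0, x ∈ H, Borel Γ). Assume: (1) the set of invariant probability measures of (P_t) is compact in the topology of weak convergence; (2) weak irreducibility: there exists a point x* ∈ H lying in the support of every invariant probability measure; (3) strong Feller: for some t > 0, for every bounded Borel function φ : H → ℝ the map x ↦ ∫ φ(y) P_t(x,dy) is continuous. Then (P_t)_{t≥0} has at most one invariant probability measure. -/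
open MeasureTheory ProbabilityTheory

namespace ProbabilityTheory.Kernel

variable {α : Type*} {mα : MeasurableSpace α} {κ : Kernel α α} {μ ν : Measure α}

/-- The difference (positive part) of two finite invariant measures is invariant. -/
theorem Invariant.sub [IsMarkovKernel κ] [IsFiniteMeasure μ] [IsFiniteMeasure ν]
    (hμ : κ.Invariant μ) (hν : κ.Invariant ν) : κ.Invariant (μ - ν) := by
  refine (Measure.eq_of_le_of_measure_univ_eq (Measure.sub_le_of_le_add ?_) ?_).symm
  · refine Measure.le_iff.2 fun s hs => ?_
    calc μ s = (μ.bind κ) s := by rw [hμ.def]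
      _ = ∫⁻ x, κ x s ∂μ := Measure.bind_apply hs κ.aemeasurable
      _ ≤ ∫⁻ x, κ x s ∂((μ - ν) + ν) :=
        lintegral_mono' (Measure.sub_le_iff_le_add.1 le_rfl) le_rfl
      _ = ((μ - ν).bind κ) s + (ν.bind κ) s := by
        rw [lintegral_add_measure, Measure.bind_apply hs κ.aemeasurable,
          Measure.bind_apply hs κ.aemeasurable]
      _ = ((μ - ν).bind κ + ν) s := by rw [hν.def, Measure.add_apply]
  · rw [Measure.bind_apply .univ κ.aemeasurable]
    simp

/-- If the kernel maps indicators to continuous functions and `x` lies in the support of two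
invariant measures, then these measures are not mutually singular. -/
theorem Invariant.not_mutuallySingular [TopologicalSpace α] [IsMarkovKernel κ]
    {x : α}
    (hκ : ∀ s, MeasurableSet s → Continuous fun y => κ y s)
    (hμ : κ.Invariant μ) (hν : κ.Invariant ν)
    (hxμ : ∀ U, IsOpen U → x ∈ U → 0 < μ U) (hxν : ∀ U, IsOpen U → x ∈ U → 0 < ν U) :
    ¬ μ ⟂ₘ ν := by
  have vanish : ∀ (ρ : Measure α), κ.Invariant ρ → (∀ U, IsOpen U → x ∈ U → 0 < ρ U) →
      ∀ s, MeasurableSet s → ρ s = 0 → κ x s = 0 := by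
    intro ρ hρ hxρ s hs h0
    by_contra hne
    have hint : ∫⁻ y, κ y s ∂ρ = 0 := by
      rw [← Measure.bind_apply hs κ.aemeasurable, hρ.def, h0]
    rw [lintegral_eq_zero_iff (κ.measurable_coe hs)] at hint
    exact (hxρ {y | κ y s ≠ 0} (isOpen_ne.preimage (hκ s hs)) hne).ne' (ae_iff.1 hint)
  rintro ⟨s, hs, h1, h2⟩
  have h := measure_add_measure_compl (μ := κ x) hs
  rw [vanish μ hμ hxμ s hs h1, vanish ν hν hxν _ hs.compl h2, measure_univ] at h
  simp at h

end ProbabilityTheory.Kernel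

/-- **Doob–Khasminskii type uniqueness theorem.**
Let `H` be a Polish space and `(P t)` for `t ≥ 0` a Markov semigroup of kernels on `H`.
If (1) the set of invariant probability measures is compact in the topology of weak
convergence, (2) there is a point `xstar` in the support of every invariant probability
measure (weak irreducibility), and (3) for some `t > 0` the kernel `P t` is strong Feller,
then there is at most one invariant probability measure. -/
theorem uniqueness_of_invariant_measure_of_weakIrreducible_of_strongFeller
    {H : Type*} [MetricSpace H] [CompleteSpace H] [TopologicalSpace.SeparableSpace H]
    [MeasurableSpace H] [BorelSpace H]
    (P : ℝ → Kernel H H) (hMarkov : ∀ t, IsMarkovKernel (P t))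
    (hzero : ∀ x : H, P 0 x = Measure.dirac x)
    (hsemigroup : ∀ s t : ℝ, 0 ≤ s → 0 ≤ t → ∀ (x : H) (Γ : Set H), MeasurableSet Γ →
      P (t + s) x Γ = ∫⁻ y, P t y Γ ∂(P s x))
    (hcompact : IsCompact {μ : ProbabilityMeasure H |
      ∀ t : ℝ, 0 ≤ t → ∀ Γ : Set H, MeasurableSet Γ →
        ∫⁻ x, P t x Γ ∂(μ : Measure H) = (μ : Measure H) Γ})
    (hirred : ∃ xstar : H, ∀ μ : ProbabilityMeasure H,
      (∀ t : ℝ, 0 ≤ t → ∀ Γ : Set H, MeasurableSet Γ →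
        ∫⁻ x, P t x Γ ∂(μ : Measure H) = (μ : Measure H) Γ) →
      ∀ O : Set H, IsOpen O → xstar ∈ O → 0 < (μ : Measure H) O)
    (hStrongFeller : ∃ t : ℝ, 0 < t ∧ ∀ φ : H → ℝ, Measurable φ →
      (∃ C : ℝ, ∀ x : H, |φ x| ≤ C) → Continuous fun x : H => ∫ y, φ y ∂(P t x)) :
    ∀ μ ν : ProbabilityMeasure H,
      (∀ t : ℝ, 0 ≤ t → ∀ Γ : Set H, MeasurableSet Γ →
        ∫⁻ x, P t x Γ ∂(μ : Measure H) = (μ : Measure H) Γ) →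
      (∀ t : ℝ, 0 ≤ t → ∀ Γ : Set H, MeasurableSet Γ →
        ∫⁻ x, P t x Γ ∂(ν : Measure H) = (ν : Measure H) Γ) →
      μ = ν := by
  obtain ⟨x, hx⟩ := hirred
  obtain ⟨t, ht, hSF⟩ := hStrongFeller
  have invariant_iff (ρ : Measure H) : (∀ t : ℝ, 0 ≤ t → ∀ Γ : Set H, MeasurableSet Γ →
      ∫⁻ x, P t x Γ ∂ρ = ρ Γ) ↔ ∀ t : ℝ, 0 ≤ t → (P t).Invariant ρ := by
    refine forall₂_congr fun t _ => ⟨fun h => Measure.ext fun s hs => ?_, fun h Γ hΓ => ?_⟩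
    · rw [Measure.bind_apply hs (P t).aemeasurable, h s hs]
    · rw [← Measure.bind_apply hΓ (P t).aemeasurable, h.def]
  have hcont (s : Set H) (hs : MeasurableSet s) : Continuous fun y => P t y s := by
    have h := ENNReal.continuous_ofReal.comp (hSF (s.indicator 1)
      (measurable_one.indicator hs) ⟨1, fun y => by by_cases hy : y ∈ s <;> simp [hy]⟩)
    refine h.congr fun y => ?_
    simp [integral_indicator_one hs]
  have support (ρ : Measure H) [IsFiniteMeasure ρ] (hρ : ρ ≠ 0)
      (hinv : ∀ t : ℝ, 0 ≤ t → (P t).Invariant ρ) (U : Set H) (hU : IsOpen U) (hxU : x ∈ U) :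
      0 < ρ U := by
    have : NeZero ρ := ⟨hρ⟩
    have h := hx ⟨(ρ Set.univ)⁻¹ • ρ, inferInstance⟩ (fun t ht Γ hΓ => by
      simp [(invariant_iff ρ).2 hinv t ht Γ hΓ]) U hU hxU
    refine pos_iff_ne_zero.2 fun h0 => h.ne' ?_
    simp [h0]
  have eq_of_sub_eq_zero (μ ν : ProbabilityMeasure H) (h : (μ : Measure H) - ν = 0) : μ = ν :=
    ProbabilityMeasure.toMeasure_injective <| Measure.eq_of_le_of_isProbabilityMeasure <| by
      simpa using Measure.sub_le_iff_le_add.1 h.le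
  intro μ ν hμ hν
  rw [invariant_iff] at hμ hν
  by_contra hne
  have hμν (t : ℝ) (ht : 0 ≤ t) := (hμ t ht).sub (hν t ht)
  have hνμ (t : ℝ) (ht : 0 ≤ t) := (hν t ht).sub (hμ t ht)
  exact (hμν t ht.le).not_mutuallySingular hcont (hνμ t ht.le)
    (support _ (fun h => hne (eq_of_sub_eq_zero μ ν h)) hμν)
    (support _ (fun h => hne (eq_of_sub_eq_zero ν μ h).symm) hνμ)
    (Measure.mutually_singular_measure_sub)
end

section
/- Let H be a Polish space and let κ be a Markov kernel on H such that the map x ↦ κ(x,·) is continuous with respect to the total variation norm. Let μ₁ and μ₂ be probability measures invariant for κ (∫ κ(x,Γ) dμᵢ(x) = μᵢ(Γ) for every Borel Γ, i = 1,2), and suppose there exists a point x* lying in the support of both μ₁ and μ₂. Then ‖μ₁ − μ₂‖_TV < 1; in particular μ₁ and μ₂ are not mutually singular. -/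
open MeasureTheory ProbabilityTheory

/-- The total variation distance between two (finite) measures:
the supremum over measurable sets `Γ` of `|μ Γ - ν Γ|`. -/
noncomputable def tvDist {H : Type*} [MeasurableSpace H] (μ ν : Measure H) : ℝ :=
  ⨆ Γ : {s : Set H // MeasurableSet s}, |(μ Γ).toReal - (ν Γ).toReal|

lemma bddAbove_range_abs_measure_sub {H : Type*} [MeasurableSpace H] (μ ν : Measure H)
    [IsProbabilityMeasure μ] [IsProbabilityMeasure ν] :
    BddAbove (Set.range fun Γ : {s : Set H // MeasurableSet s} ↦
      |(μ Γ).toReal - (ν Γ).toReal|) := by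
  refine ⟨1, ?_⟩
  rintro _ ⟨Γ, rfl⟩
  exact abs_sub_le_of_nonneg_of_le measureReal_nonneg measureReal_le_one
    measureReal_nonneg measureReal_le_one

lemma abs_measureReal_sub_le_tvDist {H : Type*} [MeasurableSpace H] (μ ν : Measure H)
    [IsProbabilityMeasure μ] [IsProbabilityMeasure ν] {Γ : Set H} (hΓ : MeasurableSet Γ) :
    |μ.real Γ - ν.real Γ| ≤ tvDist μ ν :=
  le_ciSup (bddAbove_range_abs_measure_sub μ ν) ⟨Γ, hΓ⟩

lemma one_le_tvDist_of_mutuallySingular {H : Type*} [MeasurableSpace H] {μ ν : Measure H}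
    [IsProbabilityMeasure μ] [IsProbabilityMeasure ν] (h : μ ⟂ₘ ν) : 1 ≤ tvDist μ ν := by
  obtain ⟨s, hs, hμ, hν⟩ := h
  have hν' : ν.real s = 1 := by
    have := probReal_add_probReal_compl (μ := ν) hs
    rwa [measureReal_def ν sᶜ, hν, ENNReal.toReal_zero, add_zero] at this
  have := abs_measureReal_sub_le_tvDist μ ν hs
  rwa [hν', measureReal_def μ s, hμ, ENNReal.toReal_zero, zero_sub, abs_neg, abs_one] at this

/-- A uniform lower bound for `κ y Γ` over `y ∈ B` gives a lower bound for the mass that an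
invariant measure puts on `Γ`. -/
lemma mul_measureReal_le_of_invariant {H : Type*} [MeasurableSpace H] (κ : Kernel H H)
    [IsMarkovKernel κ] (μ : Measure H) [IsProbabilityMeasure μ] {Γ B : Set H}
    (hΓ : MeasurableSet Γ) (hinv : ∫⁻ x, κ x Γ ∂μ = μ Γ) {c : ℝ} (hc : 0 ≤ c)
    (h : ∀ y ∈ B, c ≤ (κ y).real Γ) : c * μ.real B ≤ μ.real Γ := by
  have key : ENNReal.ofReal c * μ B ≤ μ Γ := by
    calc ENNReal.ofReal c * μ B
        ≤ ENNReal.ofReal c * μ {y | ENNReal.ofReal c ≤ κ y Γ} := by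
          gcongr
          exact fun y hy ↦ ENNReal.ofReal_le_of_le_toReal (h y hy)
      _ ≤ ∫⁻ x, κ x Γ ∂μ := mul_meas_ge_le_lintegral (κ.measurable_coe hΓ) _
      _ = μ Γ := hinv
  have := ENNReal.toReal_mono (measure_ne_top μ Γ) key
  rwa [ENNReal.toReal_mul, ENNReal.toReal_ofReal hc] at this

/-- If a Markov kernel `κ` on a Polish space is continuous in the total variation norm,
and `μ₁, μ₂` are two `κ`-invariant probability measures whose supports share a common point
`xstar`, then `‖μ₁ - μ₂‖_TV < 1`; in particular `μ₁` and `μ₂` are not mutually singular. -/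
theorem tvDist_lt_one_of_invariant_of_common_support_point
    {H : Type*} [MetricSpace H] [CompleteSpace H] [TopologicalSpace.SeparableSpace H]
    [MeasurableSpace H] [BorelSpace H]
    (κ : Kernel H H) [IsMarkovKernel κ]
    (hTVcont : ∀ x : H, ∀ ε : ℝ, 0 < ε → ∃ δ : ℝ, 0 < δ ∧
      ∀ y : H, dist y x < δ → tvDist (κ y) (κ x) < ε)
    (μ₁ μ₂ : Measure H) [IsProbabilityMeasure μ₁] [IsProbabilityMeasure μ₂]
    (hinv₁ : ∀ Γ : Set H, MeasurableSet Γ → ∫⁻ x, κ x Γ ∂μ₁ = μ₁ Γ)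
    (hinv₂ : ∀ Γ : Set H, MeasurableSet Γ → ∫⁻ x, κ x Γ ∂μ₂ = μ₂ Γ)
    (xstar : H)
    (hsupp₁ : ∀ O : Set H, IsOpen O → xstar ∈ O → 0 < μ₁ O)
    (hsupp₂ : ∀ O : Set H, IsOpen O → xstar ∈ O → 0 < μ₂ O) :
    tvDist μ₁ μ₂ < 1 ∧ ¬ μ₁ ⟂ₘ μ₂ := by
  suffices htv : tvDist μ₁ μ₂ < 1 from
    ⟨htv, fun h ↦ (one_le_tvDist_of_mutuallySingular h).not_gt htv⟩
  obtain ⟨δ, hδ, hδκ⟩ := hTVcont xstar (1 / 4) (by norm_num)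
  set B := Metric.ball xstar δ
  have hB : ∀ {μ : Measure H} [IsProbabilityMeasure μ],
      (∀ O : Set H, IsOpen O → xstar ∈ O → 0 < μ O) → 0 < μ.real B := fun hμ ↦
    ENNReal.toReal_pos (hμ B Metric.isOpen_ball (Metric.mem_ball_self hδ)).ne'
      (measure_ne_top _ _)
  obtain ⟨a, ha, ha₁, ha₂⟩ : ∃ a, 0 < a ∧ a ≤ μ₁.real B ∧ a ≤ μ₂.real B :=
    ⟨_, lt_min (hB hsupp₁) (hB hsupp₂), min_le_left _ _, min_le_right _ _⟩
  have lower : ∀ Γ : Set H, MeasurableSet Γ → 1 / 2 ≤ (κ xstar).real Γ →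
      1 / 4 * a ≤ μ₁.real Γ ∧ 1 / 4 * a ≤ μ₂.real Γ := by
    intro Γ hΓ hhalf
    have hy : ∀ y ∈ B, 1 / 4 ≤ (κ y).real Γ := fun y hy ↦ by
      have := (abs_lt.1 ((abs_measureReal_sub_le_tvDist (κ y) (κ xstar) hΓ).trans_lt
        (hδκ y hy))).1
      linarith
    have h₁ := mul_measureReal_le_of_invariant κ μ₁ hΓ (hinv₁ Γ hΓ) (by norm_num) hy
    have h₂ := mul_measureReal_le_of_invariant κ μ₂ hΓ (hinv₂ Γ hΓ) (by norm_num) hy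
    constructor <;> linarith
  have : Nonempty {s : Set H // MeasurableSet s} := ⟨⟨∅, MeasurableSet.empty⟩⟩
  refine (ciSup_le fun Γ ↦ ?_ : tvDist μ₁ μ₂ ≤ 1 - 1 / 4 * a).trans_lt (by linarith)
  obtain ⟨Γ, hΓ⟩ := Γ
  change |μ₁.real Γ - μ₂.real Γ| ≤ _
  have e := probReal_add_probReal_compl (μ := κ xstar) hΓ
  have e₁ := probReal_add_probReal_compl (μ := μ₁) hΓ
  have e₂ := probReal_add_probReal_compl (μ := μ₂) hΓ
  have n₁ : 0 ≤ μ₁.real Γ := measureReal_nonneg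
  have n₂ : 0 ≤ μ₂.real Γ := measureReal_nonneg
  have n₁' : 0 ≤ μ₁.real Γᶜ := measureReal_nonneg
  have n₂' : 0 ≤ μ₂.real Γᶜ := measureReal_nonneg
  rw [abs_le]
  rcases le_total (1 / 2) ((κ xstar).real Γ) with h | h
  · obtain ⟨h₁, h₂⟩ := lower Γ hΓ h
    constructor <;> linarith
  · obtain ⟨h₁, h₂⟩ := lower Γᶜ hΓ.compl (by linarith)
    constructor <;> linarith
end

section
/- Let H be a Polish space and (P_t)_{t≥0} a Markov semigroup of kernels on H (P_0(x,·) = δ_x, P_{t+s}(x,Γ) = ∫ P_t(y,Γ) P_s(x,dy)) which is jointly measurable in (t,x) and Feller, i.e. for every t ≥ 0 and every bounded continuous φ : H → ℝ the function x ↦ ∫ φ(y) P_t(x,dy) is bounded and continuous. Fix x₀ ∈ H and define for T > 0 the probability measure μ_T by μ_T(Γ) = (1/T) ∫₀^T P_t(x₀,Γ) dt. If T_j → ∞ and μ_{T_j} converges weakly to a probability measure μ, then μ is invariant for (P_t)_{t≥0}, i.e. ∫ P_t(x,Γ) dμ(x) = μ(Γ) for every t ≥ 0 and every Borel Γ. 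-/
open MeasureTheory ProbabilityTheory Filter

/-- Shifting the window of a time average of a bounded function by a fixed amount does not change
the average asymptotically. -/
theorem tendsto_shifted_average_sub_average {g : ℝ → ℝ} (hg : Measurable g) {C : ℝ}
    (hC : ∀ s, |g s| ≤ C) {t : ℝ} (ht : 0 ≤ t) {T : ℕ → ℝ} (hT : Tendsto T atTop atTop) :
    Tendsto (fun n => (T n)⁻¹ * (∫ s in (0 : ℝ)..T n, g (s + t)) -
      (T n)⁻¹ * ∫ s in (0 : ℝ)..T n, g s) atTop (nhds 0) := by
  have hint (a b : ℝ) : IntervalIntegrable g volume a b :=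
    intervalIntegrable_const (c := C) |>.mono_fun hg.aestronglyMeasurable
      (.of_forall fun s => (hC s).trans (le_abs_self C))
  have hbound (a : ℝ) : |∫ s in a..a + t, g s| ≤ C * t := by
    simpa [abs_of_nonneg ht] using
      intervalIntegral.norm_integral_le_of_norm_le_const (f := g) (a := a) (b := a + t)
        fun s _ => hC s
  have hlim : Tendsto (fun n => |(T n)⁻¹| * (C * t + C * t)) atTop (nhds 0) := by
    simpa using (tendsto_inv_atTop_zero.comp hT).abs.mul_const (C * t + C * t)
  refine squeeze_zero_norm (fun n => ?_) hlim
  have hdiff : (∫ s in (0 : ℝ)..T n, g (s + t)) - ∫ s in (0 : ℝ)..T n, g s =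
      (∫ s in T n..T n + t, g s) - ∫ s in (0 : ℝ)..0 + t, g s := by
    rw [intervalIntegral.integral_comp_add_right,
      intervalIntegral.integral_interval_sub_interval_comm' (hint _ _) (hint _ _) (hint _ _),
      zero_add]
  rw [← mul_sub, hdiff, norm_mul, Real.norm_eq_abs, Real.norm_eq_abs]
  gcongr
  exact (abs_sub _ _).trans (add_le_add (hbound _) (hbound _))

/-- The integral against `κ ∘ₘ m` is an iterated integral. -/
theorem integral_bind_kernel {X H : Type*} [MeasurableSpace X] [MeasurableSpace H]
    {m : Measure X} {κ : Kernel X H} {f : H → ℝ} (hf : Integrable f (m.bind κ)) :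
    ∫ y, f y ∂(m.bind κ) = ∫ x, ∫ y, f y ∂(κ x) ∂m := by
  have h : (κ ∘ₖ Kernel.const Unit m) () = m.bind κ := by simp
  rw [← h] at hf ⊢
  simpa using Kernel.integral_comp hf

/-- Integration against a time average of a measurable family of probability measures is the time
average of the integrals. -/
theorem integral_eq_time_average {H : Type*} [MeasurableSpace H] (κ : Kernel ℝ H)
    {T : ℝ} (hT : 0 < T) {ν : Measure H}
    (hν : ∀ Γ : Set H, MeasurableSet Γ →
      ν Γ = (ENNReal.ofReal T)⁻¹ * ∫⁻ t in Set.Icc 0 T, κ t Γ)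
    {f : H → ℝ} (hf : Integrable f ν) :
    ∫ x, f x ∂ν = T⁻¹ * ∫ s in (0 : ℝ)..T, ∫ x, f x ∂(κ s) := by
  have hν_eq : ν = (ENNReal.ofReal T)⁻¹ • (volume.restrict (Set.Icc 0 T)).bind κ := by
    ext Γ hΓ
    rw [hν Γ hΓ, Measure.smul_apply, Measure.bind_apply hΓ κ.aemeasurable, smul_eq_mul]
  have hf' : Integrable f ((volume.restrict (Set.Icc 0 T)).bind κ) := by
    rw [hν_eq] at hf
    exact (integrable_smul_measure (by simp) (by simpa using hT)).1 hf
  rw [hν_eq, integral_smul_measure, integral_bind_kernel hf',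
    intervalIntegral.integral_of_le hT.le, integral_Icc_eq_integral_Ioc, ENNReal.toReal_inv,
    ENNReal.toReal_ofReal hT.le, smul_eq_mul]

/-- **Krylov–Bogoliubov.** Let `(P t)` be a jointly measurable Feller Markov semigroup of
kernels on a Polish space `H`, let `x₀ ∈ H`, and let `μ_T` be the time average
`μ_T(Γ) = (1/T) ∫_0^T P_t(x₀,Γ) dt`.  If `T_j → ∞` and `μ_{T_j}` converges weakly to a
probability measure `μ`, then `μ` is invariant for the semigroup. -/
theorem invariant_of_weak_limit_of_time_averaged_measures
    {H : Type*} [MetricSpace H] [CompleteSpace H] [TopologicalSpace.SeparableSpace H]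
    [MeasurableSpace H] [BorelSpace H]
    (P : ℝ → Kernel H H) (hMarkov : ∀ t, IsMarkovKernel (P t))
    (hzero : ∀ x : H, P 0 x = Measure.dirac x)
    (hsemigroup : ∀ s t : ℝ, 0 ≤ s → 0 ≤ t → ∀ (x : H) (Γ : Set H), MeasurableSet Γ →
      P (t + s) x Γ = ∫⁻ y, P t y Γ ∂(P s x))
    (hjointmeas : ∀ Γ : Set H, MeasurableSet Γ →
      Measurable fun p : ℝ × H => P p.1 p.2 Γ)
    (hFeller : ∀ t : ℝ, 0 ≤ t → ∀ φ : H → ℝ, Continuous φ → (∃ C : ℝ, ∀ x : H, |φ x| ≤ C) →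
      (Continuous fun x : H => ∫ y, φ y ∂(P t x)) ∧
        ∃ C : ℝ, ∀ x : H, |∫ y, φ y ∂(P t x)| ≤ C)
    (x₀ : H) (Tj : ℕ → ℝ) (hTj_pos : ∀ n, 0 < Tj n)
    (hTj_lim : Tendsto Tj atTop atTop)
    (ν : ℕ → ProbabilityMeasure H)
    (hν : ∀ (n : ℕ) (Γ : Set H), MeasurableSet Γ →
      (ν n : Measure H) Γ = (ENNReal.ofReal (Tj n))⁻¹ * ∫⁻ t in Set.Icc 0 (Tj n), P t x₀ Γ)
    (μ : ProbabilityMeasure H) (hconv : Tendsto ν atTop (nhds μ)) :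
    ∀ t : ℝ, 0 ≤ t → ∀ Γ : Set H, MeasurableSet Γ →
      ∫⁻ x, P t x Γ ∂(μ : Measure H) = (μ : Measure H) Γ := by
  intro t ht
  let κ : Kernel ℝ H :=
    ⟨fun s => P s x₀, Measure.measurable_of_measurable_coe _ fun Γ hΓ =>
      (hjointmeas Γ hΓ).comp measurable_prodMk_right⟩
  have : IsMarkovKernel κ := ⟨fun s => (hMarkov s).isProbabilityMeasure x₀⟩
  have hsg (s : ℝ) (hs : 0 ≤ s) : P (s + t) x₀ = (P s x₀).bind (P t) := by
    ext Γ hΓ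
    rw [add_comm, hsemigroup s t hs ht x₀ Γ hΓ, Measure.bind_apply hΓ (P t).aemeasurable]
  suffices h : (μ : Measure H).bind (P t) = μ by
    intro Γ hΓ
    rw [← Measure.bind_apply hΓ (P t).aemeasurable, h]
  refine ext_of_forall_integral_eq_of_IsFiniteMeasure fun f => ?_
  have hfint (m : Measure H) [IsFiniteMeasure m] : Integrable f m := f.integrable m
  obtain ⟨hcont, C, hC⟩ := hFeller t ht f f.continuous ⟨‖f‖, f.norm_coe_le_norm⟩
  let F : BoundedContinuousFunction H ℝ := .ofNormedAddCommGroup _ hcont C hC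
  rw [integral_bind_kernel (hfint _)]
  have hweak := ProbabilityMeasure.tendsto_iff_forall_integral_tendsto.1 hconv
  have hlim := (hweak F).sub (hweak f)
  have hg : Measurable fun s => ∫ x, f x ∂(κ s) :=
    f.continuous.stronglyMeasurable.integral_kernel.measurable
  have hgC (s : ℝ) : |∫ x, f x ∂(κ s)| ≤ ‖f‖ := f.norm_integral_le_norm (κ s)
  refine sub_eq_zero.1 (tendsto_nhds_unique hlim
    ((tendsto_shifted_average_sub_average hg hgC ht hTj_lim).congr fun n => ?_))
  rw [integral_eq_time_average κ (hTj_pos n) (hν n) (F.integrable _),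
    integral_eq_time_average κ (hTj_pos n) (hν n) (hfint _)]
  congr 2
  refine intervalIntegral.integral_congr fun s hs => ?_
  rw [Set.uIcc_of_le (hTj_pos n).le] at hs
  change ∫ x, f x ∂(P (s + t) x₀) = ∫ x, ∫ y, f y ∂(P t x) ∂(P s x₀)
  rw [hsg s hs.1, integral_bind_kernel (hfint _)]
end

section
/- Let H be a Polish space and let κ₁, κ₂ be Markov kernels on H that are both strong Feller, i.e. for every bounded Borel function φ : H → ℝ the maps x ↦ ∫ φ(y) κᵢ(x,dy), i = 1,2, are continuous. Then the composed kernel (κ₁κ₂)(x,Γ) = ∫ κ₂(y,Γ) κ₁(x,dy) is continuous in total variation: x ↦ (κ₁κ₂)(x,·) is continuous from H to the space of probability measures with the total variation norm ‖ν‖_TV = sup over Borel Γ of |ν(Γ)|. -/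
open MeasureTheory ProbabilityTheory

/-- A map into a separable metric space is strongly measurable as soon as its distance to every
point is measurable. -/
theorem stronglyMeasurable_of_measurable_dist {α E : Type*} [MeasurableSpace α]
    [PseudoMetricSpace E] [SecondCountableTopology E] {f : α → E}
    (h : ∀ c, Measurable fun a => dist (f a) c) : StronglyMeasurable f := by
  borelize E
  refine Measurable.stronglyMeasurable (measurable_of_isOpen fun s hs => ?_)
  obtain ⟨t, -, hst⟩ := TopologicalSpace.isOpen_biUnion_countable
    {p : E × ℝ | Metric.ball p.1 p.2 ⊆ s} (fun p => Metric.ball p.1 p.2)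
    fun _ _ => Metric.isOpen_ball
  have hs' : s = ⋃ p ∈ {p : E × ℝ | Metric.ball p.1 p.2 ⊆ s}, Metric.ball p.1 p.2 := by
    refine Set.Subset.antisymm (fun x hx => ?_) (Set.iUnion₂_subset fun _ hp => hp)
    obtain ⟨r, hr, hrs⟩ := Metric.isOpen_iff.1 hs x hx
    exact Set.mem_biUnion (show (x, r) ∈ {p : E × ℝ | Metric.ball p.1 p.2 ⊆ s} from hrs)
      (Metric.mem_ball_self hr)
  rw [hs', ← hst.2, Set.preimage_iUnion₂]
  exact MeasurableSet.biUnion hst.1 fun p _ => measurableSet_lt (h p.1) measurable_const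

/-- Under a strong Feller Markov kernel, integrals of bounded strongly measurable vector-valued
functions are norm continuous. -/
theorem continuous_integral_of_strongFeller {X Y E : Type*} [TopologicalSpace X]
    [MeasurableSpace X] [MeasurableSpace Y] [NormedAddCommGroup E] [NormedSpace ℝ E]
    [CompleteSpace E] (κ : Kernel X Y) [IsMarkovKernel κ]
    (hκ : ∀ φ : Y → ℝ, Measurable φ → (∃ C : ℝ, ∀ y, |φ y| ≤ C) →
      Continuous fun x => ∫ y, φ y ∂(κ x))
    {F : Y → E} (hF : StronglyMeasurable F) {C : ℝ} (hC : ∀ y, ‖F y‖ ≤ C) :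
    Continuous fun x => ∫ y, F y ∂(κ x) := by
  have hint : ∀ x, Integrable F (κ x) := fun x =>
    .of_bound hF.aestronglyMeasurable C (ae_of_all _ hC)
  refine continuous_iff_continuousAt.2 fun x => Metric.tendsto_nhds.2 fun ε hε => ?_
  obtain ⟨S, hS, -⟩ := (memLp_one_iff_integrable.2 (hint x)).exists_simpleFunc_eLpNorm_sub_lt
    (by simp) (ε := ENNReal.ofReal (ε / 3)) (by simpa using hε)
  have hSi : ∀ x, Integrable S (κ x) := fun x => S.integrable_of_isFiniteMeasure
  have hSx : ∫ y, ‖F y - S y‖ ∂(κ x) < ε / 3 := by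
    rw [eLpNorm_one_eq_lintegral_enorm] at hS
    refine (integral_norm_eq_lintegral_enorm
      (hF.sub S.stronglyMeasurable).aestronglyMeasurable).trans_lt ?_
    exact (ENNReal.lt_ofReal_iff_toReal_lt (ne_top_of_lt hS)).1 hS
  obtain ⟨D, hD⟩ := S.exists_forall_norm_le
  have hφ : Continuous fun x => ∫ y, ‖F y - S y‖ ∂(κ x) :=
    hκ _ (hF.sub S.stronglyMeasurable).norm.measurable ⟨C + D, fun y => by
      rw [abs_norm]
      exact (norm_sub_le _ _).trans (add_le_add (hC y) (hD y))⟩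
  have hSc : Continuous fun x => ∫ y, S y ∂(κ x) := by
    have : (fun x => ∫ y, S y ∂(κ x)) =
        fun x => ∑ c ∈ S.range, (κ x).real (S ⁻¹' {c}) • c := by
      ext1 x
      rw [← SimpleFunc.integral_eq_integral _ (hSi x)]
      rfl
    rw [this]
    refine continuous_finsetSum _ fun c _ => Continuous.smul ?_ continuous_const
    simpa [integral_indicator_one (S.measurableSet_fiber c)] using
      hκ ((S ⁻¹' {c}).indicator 1) (measurable_one.indicator (S.measurableSet_fiber c))
        ⟨1, fun y => by by_cases hy : y ∈ S ⁻¹' {c} <;> simp [Set.indicator, hy]⟩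
  have hle : ∀ x', dist (∫ y, F y ∂(κ x')) (∫ y, S y ∂(κ x')) ≤ ∫ y, ‖F y - S y‖ ∂(κ x') := by
    intro x'
    rw [dist_eq_norm, ← integral_sub (hint x') (hSi x')]
    exact norm_integral_le_integral_norm _
  filter_upwards [hφ.continuousAt.eventually_lt_const hSx,
    Metric.tendsto_nhds.1 hSc.continuousAt (ε / 3) (by positivity)] with x' h₁ h₂
  have := dist_triangle4_right (∫ y, F y ∂(κ x')) (∫ y, F y ∂(κ x))
    (∫ y, S y ∂(κ x')) (∫ y, S y ∂(κ x))
  linarith [hle x, hle x']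

/-- All the measures of a strong Feller kernel on a separable space are absolutely continuous with
respect to a common finite measure. -/
theorem exists_absolutelyContinuous_of_strongFeller {X Y : Type*} [TopologicalSpace X]
    [TopologicalSpace.SeparableSpace X] [MeasurableSpace X] [MeasurableSpace Y]
    (κ : Kernel X Y) [IsMarkovKernel κ]
    (hκ : ∀ φ : Y → ℝ, Measurable φ → (∃ C : ℝ, ∀ y, |φ y| ≤ C) →
      Continuous fun x => ∫ y, φ y ∂(κ x)) :
    ∃ ν : Measure Y, IsFiniteMeasure ν ∧ ∀ x, κ x ≪ ν := by
  obtain hX | hX := isEmpty_or_nonempty X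
  · exact ⟨0, inferInstance, fun x => hX.elim x⟩
  let ρ := Measure.sum fun n => κ (TopologicalSpace.denseSeq X n)
  refine ⟨ρ.toFinite, inferInstance, fun x => ?_⟩
  refine Measure.AbsolutelyContinuous.trans (.mk fun s hs h0 => ?_) (absolutelyContinuous_toFinite ρ)
  have hcont : Continuous fun x => (κ x).real s := by
    simpa [integral_indicator_one hs] using
      hκ (s.indicator 1) (measurable_one.indicator hs)
        ⟨1, fun y => by by_cases hy : y ∈ s <;> simp [Set.indicator, hy]⟩
  have hzero : (fun x => (κ x).real s) = fun _ => 0 := by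
    refine (TopologicalSpace.denseRange_denseSeq X).equalizer hcont continuous_const ?_
    ext1 n
    simp [measureReal_def, Measure.sum_apply_eq_zero.1 h0 n]
  exact (measureReal_eq_zero_iff).1 (congrFun hzero x)

/-- The map sending a point to the density of a finite kernel, as an element of `L¹`, is strongly
measurable. -/
theorem stronglyMeasurable_toL1_rnDeriv {X Y : Type*} [MeasurableSpace X] [MeasurableSpace Y]
    [MeasurableSpace.CountablyGenerated Y] (κ : Kernel X Y) [IsFiniteKernel κ]
    (ν : Measure Y) [IsFiniteMeasure ν] :
    StronglyMeasurable fun x => (Measure.integrable_toReal_rnDeriv (μ := κ x) (ν := ν)).toL1 _ := by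
  have : Fact ((1 : ENNReal) ≠ ⊤) := ⟨ENNReal.one_ne_top⟩
  refine stronglyMeasurable_of_measurable_dist fun g => ?_
  have hdist : (fun x => dist ((Measure.integrable_toReal_rnDeriv (μ := κ x) (ν := ν)).toL1 _) g) =
      fun x => ∫ y, ‖(Kernel.rnDeriv κ (Kernel.const X ν) x y).toReal - g y‖ ∂ν := by
    ext1 x
    rw [L1.dist_eq_integral_dist]
    have h := Kernel.rnDeriv_eq_rnDeriv_measure (κ := κ) (η := Kernel.const X ν) (a := x)
    rw [Kernel.const_apply] at h
    refine integral_congr_ae ?_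
    filter_upwards [h, (Measure.integrable_toReal_rnDeriv (μ := κ x) (ν := ν)).coeFn_toL1]
      with y h₁ h₂
    rw [h₁, h₂, dist_eq_norm]
  rw [hdist]
  refine (StronglyMeasurable.integral_prod_right' (f := fun p : X × Y =>
    ‖(Kernel.rnDeriv κ (Kernel.const X ν) p.1 p.2).toReal - g p.2‖) ?_).measurable
  exact ((Kernel.measurable_rnDeriv κ _).ennreal_toReal.stronglyMeasurable.sub
    ((Lp.stronglyMeasurable g).comp_measurable measurable_snd)).norm

/-- If `κ₁, κ₂` are strong Feller Markov kernels on a Polish space `H`, then the composed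
kernel `(κ₁κ₂)(x,Γ) = ∫ κ₂(y,Γ) κ₁(x,dy)` is continuous in the total variation norm as a
function of `x`. -/
theorem composition_of_strongFeller_kernels_tv_continuous
    {H : Type*} [MetricSpace H] [CompleteSpace H] [TopologicalSpace.SeparableSpace H]
    [MeasurableSpace H] [BorelSpace H]
    (κ₁ κ₂ : Kernel H H) [IsMarkovKernel κ₁] [IsMarkovKernel κ₂]
    (hSF₁ : ∀ φ : H → ℝ, Measurable φ → (∃ C : ℝ, ∀ x : H, |φ x| ≤ C) →
      Continuous fun x : H => ∫ y, φ y ∂(κ₁ x))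
    (hSF₂ : ∀ φ : H → ℝ, Measurable φ → (∃ C : ℝ, ∀ x : H, |φ x| ≤ C) →
      Continuous fun x : H => ∫ y, φ y ∂(κ₂ x)) :
    ∀ x : H, ∀ ε : ℝ, 0 < ε → ∃ δ : ℝ, 0 < δ ∧ ∀ x' : H, dist x' x < δ →
      tvDist ((κ₁ x).bind (fun y => κ₂ y)) ((κ₁ x').bind (fun y => κ₂ y)) < ε := by
  obtain ⟨ν, hν, hac⟩ := exists_absolutelyContinuous_of_strongFeller κ₂ hSF₂
  have : SecondCountableTopology H := UniformSpace.secondCountable_of_separable H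
  set F : H → Lp ℝ 1 ν :=
    fun y => (Measure.integrable_toReal_rnDeriv (μ := κ₂ y) (ν := ν)).toL1 _ with hFdef
  have hF : StronglyMeasurable F := stronglyMeasurable_toL1_rnDeriv κ₂ ν
  have hFset : ∀ y Γ, ∫ z in Γ, F y z ∂ν = (κ₂ y).real Γ := by
    intro y Γ
    rw [← Measure.setIntegral_toReal_rnDeriv (hac y) Γ]
    exact integral_congr_ae (ae_restrict_of_ae (Integrable.coeFn_toL1 _))
  have hFbound : ∀ y, ‖F y‖ ≤ 1 := by
    intro y
    rw [hFdef, L1.norm_of_fun_eq_integral_norm]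
    simp only [Real.norm_eq_abs, ENNReal.abs_toReal]
    rw [Measure.integral_toReal_rnDeriv (hac y)]
    simp
  have hcomp : ∀ x Γ, MeasurableSet Γ →
      ((κ₁ x).bind (fun y => κ₂ y) Γ).toReal = ∫ z in Γ, (∫ y, F y ∂(κ₁ x) : Lp ℝ 1 ν) z ∂ν := by
    intro x Γ hΓ
    let T : Lp ℝ 1 ν →L[ℝ] ℝ := (L1.integralCLM (E := ℝ) (μ := ν.restrict Γ)).comp
      (LpToLpRestrictCLM H ℝ ℝ ν 1 Γ)
    have hT : ∀ f : Lp ℝ 1 ν, T f = ∫ z in Γ, f z ∂ν := by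
      intro f
      rw [← integral_congr_ae (LpToLpRestrictCLM_coeFn ℝ Γ f), ← L1.integral_eq_integral,
        L1.integral_eq]
      rfl
    have hFi : Integrable F (κ₁ x) :=
      .of_bound hF.aestronglyMeasurable 1 (ae_of_all _ hFbound)
    rw [← hT, ← T.integral_comp_comm hFi]
    simp_rw [hT, hFset, measureReal_def]
    rw [Measure.bind_apply hΓ κ₂.measurable.aemeasurable,
      integral_toReal (κ₂.measurable_coe hΓ).aemeasurable (ae_of_all _ fun y => measure_lt_top _ _)]
  have hcont := continuous_integral_of_strongFeller κ₁ hSF₁ hF hFbound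
  intro x ε hε
  obtain ⟨δ, hδ, h⟩ := Metric.continuous_iff.1 hcont x ε hε
  refine ⟨δ, hδ, fun x' hx' => lt_of_le_of_lt ?_ (h x' hx')⟩
  have : Nonempty {s : Set H // MeasurableSet s} := ⟨⟨∅, .empty⟩⟩
  refine ciSup_le fun ⟨Γ, hΓ⟩ => ?_
  rw [hcomp x Γ hΓ, hcomp x' Γ hΓ, ← integral_sub (L1.integrable_coeFn _).integrableOn
    (L1.integrable_coeFn _).integrableOn, dist_comm, L1.dist_eq_integral_dist]
  have hi := (L1.integrable_coeFn (∫ y, F y ∂(κ₁ x) : Lp ℝ 1 ν)).sub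
    (L1.integrable_coeFn (∫ y, F y ∂(κ₁ x') : Lp ℝ 1 ν))
  exact (norm_integral_le_integral_norm _).trans
    (setIntegral_le_integral hi.norm (ae_of_all _ fun _ => norm_nonneg _))
end

section
/- Fix t > 0 and α ∈ (0,1]. Let f : [0,t] → ℝ be continuously differentiable with f' α-Hölder continuous, and suppose f is not identically zero. Then ‖f'‖_{L^∞} ≤ 4 ‖f‖_{L^∞} · max{ 1/t , ‖f‖_{L^∞}^{−1/(1+α)} ‖f'‖_{C^α}^{1/(1+α)} }, where ‖g‖_{L^∞} = sup_{s∈[0,t]} |g(s)| and ‖g‖_{C^α} = ‖g‖_{L^∞} + sup_{s≠r in [0,t]} |g(s) − g(r)|/|s − r|^α. -/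
open Set

/-- The sup norm `‖g‖_{L^∞}` of `g : ℝ → ℝ` over the interval `[0,t]`. -/
noncomputable def supNormIcc (t : ℝ) (g : ℝ → ℝ) : ℝ :=
  ⨆ s : Icc (0 : ℝ) t, |g s|

/-- The `α`-Hölder seminorm of `g : ℝ → ℝ` over the interval `[0,t]`
(the diagonal terms `s = r` contribute `0/0 = 0` and hence do not affect the value). -/
noncomputable def holderSeminormIcc (t α : ℝ) (g : ℝ → ℝ) : ℝ :=
  ⨆ p : Icc (0 : ℝ) t × Icc (0 : ℝ) t, |g p.1 - g p.2| / |(p.1 : ℝ) - (p.2 : ℝ)| ^ α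

theorem abs_le_supNormIcc {t : ℝ} {g : ℝ → ℝ}
    (hg : BddAbove (range fun s : Icc (0 : ℝ) t => |g s|)) {s : ℝ} (hs : s ∈ Icc (0 : ℝ) t) :
    |g s| ≤ supNormIcc t g :=
  le_ciSup hg ⟨s, hs⟩

theorem supNormIcc_nonneg (t : ℝ) (g : ℝ → ℝ) : 0 ≤ supNormIcc t g :=
  Real.iSup_nonneg fun _ => abs_nonneg _

theorem holderSeminormIcc_nonneg (t α : ℝ) (g : ℝ → ℝ) : 0 ≤ holderSeminormIcc t α g :=
  Real.iSup_nonneg fun _ => by positivity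

theorem bddAbove_abs_of_continuousOn {t : ℝ} {g : ℝ → ℝ} (hg : ContinuousOn g (Icc 0 t)) :
    BddAbove (range fun s : Icc (0 : ℝ) t => |g s|) := by
  obtain ⟨C, hC⟩ := isCompact_Icc.exists_bound_of_continuousOn hg
  exact ⟨C, by rintro _ ⟨s, rfl⟩; exact hC s s.2⟩

theorem abs_sub_le_holderSeminormIcc_mul {t α C : ℝ} {g : ℝ → ℝ}
    (hC : ∀ s ∈ Icc (0 : ℝ) t, ∀ r ∈ Icc (0 : ℝ) t, |g s - g r| ≤ C * |s - r| ^ α)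
    {s r : ℝ} (hs : s ∈ Icc (0 : ℝ) t) (hr : r ∈ Icc (0 : ℝ) t) :
    |g s - g r| ≤ holderSeminormIcc t α g * |s - r| ^ α := by
  rcases eq_or_ne s r with rfl | hne
  · rw [sub_self, abs_zero]
    exact mul_nonneg (holderSeminormIcc_nonneg t α g) (by positivity)
  have hbdd : BddAbove (range fun p : Icc (0 : ℝ) t × Icc (0 : ℝ) t =>
      |g p.1 - g p.2| / |(p.1 : ℝ) - (p.2 : ℝ)| ^ α) := by
    refine ⟨|C|, ?_⟩
    rintro _ ⟨⟨⟨x, hx⟩, ⟨y, hy⟩⟩, rfl⟩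
    refine div_le_of_le_mul₀ (by positivity) (abs_nonneg C) ((hC x hx y hy).trans ?_)
    gcongr
    exact le_abs_self C
  have hpos : 0 < |s - r| ^ α := Real.rpow_pos_of_pos (abs_pos.2 (sub_ne_zero.2 hne)) α
  exact (div_le_iff₀ hpos).1 (le_ciSup hbdd (⟨s, hs⟩, ⟨r, hr⟩))

/-- The derivative at a point is controlled by the oscillation of the function over an interval
of length `h` around the point, plus the Hölder oscillation of the derivative. -/
theorem abs_deriv_le_of_holder {t α h M H : ℝ} (hα : 0 ≤ α) (hh : 0 < h) (hht : h ≤ t)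
    (hH : 0 ≤ H) {f f' : ℝ → ℝ}
    (hderiv : ∀ s ∈ Icc (0 : ℝ) t, HasDerivWithinAt f (f' s) (Icc (0 : ℝ) t) s)
    (hM : ∀ s ∈ Icc (0 : ℝ) t, |f s| ≤ M)
    (hholder : ∀ s ∈ Icc (0 : ℝ) t, ∀ r ∈ Icc (0 : ℝ) t, |f' s - f' r| ≤ H * |s - r| ^ α)
    {s : ℝ} (hs : s ∈ Icc (0 : ℝ) t) :
    |f' s| ≤ 2 * M / h + H * h ^ α := by
  obtain ⟨a, ha0, hat, has, hsa⟩ : ∃ a, 0 ≤ a ∧ a + h ≤ t ∧ a ≤ s ∧ s ≤ a + h := by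
    rcases le_total s (t - h) with hc | hc
    · exact ⟨s, hs.1, by linarith, le_rfl, by linarith⟩
    · exact ⟨t - h, by linarith, by linarith, hc, by linarith [hs.2]⟩
  have hsub : Icc a (a + h) ⊆ Icc 0 t := Icc_subset_Icc ha0 hat
  obtain ⟨ξ, hξ, hslope⟩ := exists_hasDerivAt_eq_slope f f' (lt_add_of_pos_right a hh)
    (fun x hx => ((hderiv x (hsub hx)).continuousWithinAt.mono hsub))
    (fun x hx => (hderiv x (hsub (Ioo_subset_Icc_self hx))).hasDerivAt
      (Icc_mem_nhds (ha0.trans_lt hx.1) (hx.2.trans_le hat)))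
  have hξt : ξ ∈ Icc 0 t := hsub (Ioo_subset_Icc_self hξ)
  have hfξ : |f' ξ| ≤ 2 * M / h := by
    rw [hslope, add_sub_cancel_left, abs_div, abs_of_pos hh]
    gcongr
    have h₁ := hM a (hsub ⟨le_rfl, by linarith⟩)
    have h₂ := hM (a + h) (hsub ⟨by linarith, le_rfl⟩)
    have := abs_sub (f (a + h)) (f a)
    linarith
  have hosc : |f' s - f' ξ| ≤ H * h ^ α := by
    refine (hholder s hs ξ hξt).trans ?_
    gcongr
    exact abs_le.2 ⟨by linarith [hξ.2], by linarith [hξ.1]⟩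
  have := abs_sub_abs_le_abs_sub (f' s) (f' ξ)
  linarith

/-- **Interpolation inequality.** For `t > 0`, `α ∈ (0,1]` and `f ∈ C^{1,α}([0,t])` not
identically zero,
`‖f'‖_{L^∞} ≤ 4 ‖f‖_{L^∞} max{ 1/t, ‖f‖_{L^∞}^{-1/(1+α)} ‖f'‖_{C^α}^{1/(1+α)} }`,
where `‖f'‖_{C^α} = ‖f'‖_{L^∞} + [f']_{C^α}`. -/
theorem supNorm_deriv_le_interpolation
    (t α : ℝ) (ht : 0 < t) (hα0 : 0 < α) (hα1 : α ≤ 1)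
    (f f' : ℝ → ℝ)
    (hderiv : ∀ s ∈ Icc (0 : ℝ) t, HasDerivWithinAt f (f' s) (Icc (0 : ℝ) t) s)
    (hholder : ∃ C : ℝ, ∀ s ∈ Icc (0 : ℝ) t, ∀ r ∈ Icc (0 : ℝ) t,
      |f' s - f' r| ≤ C * |s - r| ^ α)
    (hne : ∃ s ∈ Icc (0 : ℝ) t, f s ≠ 0) :
    supNormIcc t f' ≤ 4 * supNormIcc t f *
      max (1 / t)
        ((supNormIcc t f) ^ (-(1 / (1 + α))) *
          (supNormIcc t f' + holderSeminormIcc t α f') ^ (1 / (1 + α))) := by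
  obtain ⟨C, hC⟩ := hholder
  have hf : BddAbove (range fun s : Icc (0 : ℝ) t => |f s|) :=
    bddAbove_abs_of_continuousOn fun s hs => (hderiv s hs).continuousWithinAt
  have hMpos : 0 < supNormIcc t f := by
    obtain ⟨s, hs, hfs⟩ := hne
    exact (abs_pos.2 hfs).trans_le (abs_le_supNormIcc hf hs)
  have hD := supNormIcc_nonneg t f'
  have hH := holderSeminormIcc_nonneg t α f'
  set M := supNormIcc t f
  set H := holderSeminormIcc t α f'
  set N := supNormIcc t f' + H
  set L := max (1 / t) (M ^ (-(1 / (1 + α))) * N ^ (1 / (1 + α)))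
  have hN : 0 ≤ N := add_nonneg hD hH
  have hL : 0 < L := (one_div_pos.2 ht).trans_le (le_max_left _ _)
  have hα : 0 < 1 + α := by linarith
  have hNL : N ≤ M * L ^ α * L := by
    have hpow : (M ^ (-(1 / (1 + α))) * N ^ (1 / (1 + α))) ^ (1 + α) = M⁻¹ * N := by
      rw [Real.mul_rpow (by positivity) (by positivity), ← Real.rpow_mul hMpos.le,
        ← Real.rpow_mul hN, neg_mul, one_div_mul_cancel hα.ne', Real.rpow_neg_one, Real.rpow_one]
    have hle : M⁻¹ * N ≤ L ^ (1 + α) :=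
      hpow ▸ Real.rpow_le_rpow (by positivity) (le_max_right _ _) hα.le
    rw [add_comm, Real.rpow_add_one hL.ne', inv_mul_le_iff₀ hMpos] at hle
    linarith
  have hHL : H * L⁻¹ ^ α ≤ M * L := by
    rw [Real.inv_rpow hL.le, ← div_eq_mul_inv, div_le_iff₀ (by positivity)]
    linarith [show H ≤ N from le_add_of_nonneg_left hD]
  have : Nonempty (Icc (0 : ℝ) t) := ⟨⟨0, le_rfl, ht.le⟩⟩
  refine ciSup_le fun s => ?_
  have hLt : L⁻¹ ≤ t := inv_le_of_inv_le₀ ht (one_div t ▸ le_max_left (1 / t) _)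
  have key := abs_deriv_le_of_holder hα0.le (inv_pos.2 hL) hLt hH hderiv
    (fun x hx => abs_le_supNormIcc hf hx)
    (fun x hx y hy => abs_sub_le_holderSeminormIcc_mul hC hx hy) s.2
  rw [div_inv_eq_mul] at key
  have := mul_pos hMpos hL
  linarith
end
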